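/- arXiv:1709.06606 — 6 statements merged into one kernel-verified Lean document; each statement's English description precedes it below -/
import Mathlib

section
/- Let C_X ∈ ℝ^{q×q} and C_E ∈ ℝ^{n×n} be symmetric positive definite, B ∈ ℝ^{n×q}, C_Y = B C_X Bᵀ + C_E, and let V ∈ ℝ^{n×r} have full column rank r. Then Vᵀ C_E V and Vᵀ C_Y V are invertible and the following two expressions for the reduced posterior covariance coincide: C_X (C_X + C_X Bᵀ V (Vᵀ C_E V)⁻¹ Vᵀ B C_X)⁻¹ C_X = C_X − C_X Bᵀ V (Vᵀ C_Y V)⁻¹ Vᵀ B C_X. -/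
open Matrix

/-- A matrix of full column rank acts injectively on vectors. -/
theorem Matrix.mulVec_injective_of_rank_eq_card {m n K : Type*} [Fintype m] [Fintype n] [Field K]
    {A : Matrix m n K} (hA : A.rank = Fintype.card n) : Function.Injective A.mulVec := by
  rw [mulVec_injective_iff, linearIndependent_iff_card_eq_finrank_span, Set.finrank,
    ← rank_eq_finrank_span_cols, hA]

/-- Proposition 2.1 (covariance identity): for SPD `C_X`, `C_E`, design matrix `B`,
`C_Y = B C_X Bᵀ + C_E`, and full-column-rank `V`, the matrices `Vᵀ C_E V` and
`Vᵀ C_Y V` are invertible and the two expressions for the reduced posterior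
covariance coincide. -/
theorem stmt_0 {q n r : ℕ} (hr : 1 ≤ r) (hrn : r ≤ n)
    (CX : Matrix (Fin q) (Fin q) ℝ) (CE : Matrix (Fin n) (Fin n) ℝ)
    (hCX : CX.PosDef) (hCE : CE.PosDef)
    (B : Matrix (Fin n) (Fin q) ℝ)
    (CY : Matrix (Fin n) (Fin n) ℝ) (hCY : CY = B * CX * Bᵀ + CE)
    (V : Matrix (Fin n) (Fin r) ℝ) (hV : V.rank = r) :
    IsUnit (Vᵀ * CE * V) ∧ IsUnit (Vᵀ * CY * V) ∧
    CX * (CX + CX * Bᵀ * V * (Vᵀ * CE * V)⁻¹ * Vᵀ * B * CX)⁻¹ * CX =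
      CX - CX * Bᵀ * V * (Vᵀ * CY * V)⁻¹ * Vᵀ * B * CX := by
  have hinj : Function.Injective V.mulVec :=
    mulVec_injective_of_rank_eq_card (by rw [hV, Fintype.card_fin])
  have hYpos : CY.PosDef := by
    rw [hCY]
    simpa using PosDef.posSemidef_add (hCX.posSemidef.mul_mul_conjTranspose_same B) hCE
  have hE : IsUnit (Vᵀ * CE * V) := by
    simpa using (hCE.conjTranspose_mul_mul_same hinj).isUnit
  have hY : IsUnit (Vᵀ * CY * V) := by
    simpa using (hYpos.conjTranspose_mul_mul_same hinj).isUnit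
  refine ⟨hE, hY, ?_⟩
  have hXdet : IsUnit CX.det := (isUnit_iff_isUnit_det _).mp hCX.isUnit
  have hmid : (Vᵀ * CE * V)⁻¹⁻¹ + (Vᵀ * B * CX) * CX⁻¹ * (CX * Bᵀ * V) = Vᵀ * CY * V := by
    rw [nonsing_inv_nonsing_inv _ ((isUnit_iff_isUnit_det _).mp hE),
      mul_nonsing_inv_cancel_right _ _ hXdet, hCY]
    simp only [Matrix.mul_add, Matrix.add_mul, Matrix.mul_assoc]
    exact add_comm _ _
  have hW := add_mul_mul_inv_eq_sub CX (CX * Bᵀ * V) (Vᵀ * CE * V)⁻¹ (Vᵀ * B * CX)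
    hCX.isUnit (isUnit_nonsing_inv_iff.mpr hE) (hmid ▸ hY)
  rw [hmid] at hW
  simp only [Matrix.mul_assoc] at hW ⊢
  rw [hW]
  simp only [Matrix.mul_sub, Matrix.sub_mul, Matrix.mul_assoc, nonsing_inv_mul _ hXdet,
    Matrix.mul_one, nonsing_inv_mul_cancel_left _ _ hXdet]
end

section
/- Let C*, C_V ∈ ℝ^{q×q} be symmetric positive definite, C_Y ∈ ℝ^{n×n} symmetric positive definite, m_Y ∈ ℝ^n, and h*, h_V ∈ ℝ^q. Let G* ∈ ℝ^{q×n}, G_V ∈ ℝ^{q×r}, V ∈ ℝ^{n×r}, and set m*(y) = G*(y − m_Y) + h* and m_V(y) = G_V Vᵀ (y − m_Y) + h_V. Then the expected Kullback-Leibler divergence satisfies ∫ D_KL( N(m*(y), C*) ∥ N(m_V(y), C_V) ) dN(m_Y, C_Y)(y) = ½ ( trace(C* C_V⁻¹) − log det(C* C_V⁻¹) − q + trace( C_V⁻¹ (G* − G_V Vᵀ) C_Y (G* − G_V Vᵀ)ᵀ ) + (h* − h_V)ᵀ C_V⁻¹ (h* − h_V) ). -/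
open Matrix MeasureTheory

/-- Probability density function of the multivariate Gaussian `N(m, C)` on `ℝ^n`. -/
noncomputable def gaussianPdf {n : ℕ} (m : Fin n → ℝ) (C : Matrix (Fin n) (Fin n) ℝ)
    (x : Fin n → ℝ) : ℝ :=
  (Real.sqrt ((2 * Real.pi) ^ n * C.det))⁻¹ *
    Real.exp (-(1 / 2) * ((x - m) ⬝ᵥ (C⁻¹ *ᵥ (x - m))))

/-- The multivariate Gaussian measure `N(m, C)` on `ℝ^n`. -/
noncomputable def gaussianMeasure {n : ℕ} (m : Fin n → ℝ)
    (C : Matrix (Fin n) (Fin n) ℝ) : Measure (Fin n → ℝ) :=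
  MeasureTheory.volume.withDensity fun x => ENNReal.ofReal (gaussianPdf m C x)

/-- The Kullback-Leibler divergence `D_KL(N(m₀,C₀) ∥ N(m₁,C₁)) = ∫ log(f₀/f₁) dN(m₀,C₀)`. -/
noncomputable def gaussianKLDiv {q : ℕ} (m₀ m₁ : Fin q → ℝ)
    (C₀ C₁ : Matrix (Fin q) (Fin q) ℝ) : ℝ :=
  ∫ x, Real.log (gaussianPdf m₀ C₀ x / gaussianPdf m₁ C₁ x) ∂(gaussianMeasure m₀ C₀)

open ProbabilityTheory
open scoped MatrixOrder

/-- A positive semidefinite real matrix has a factorization `C = S * Sᵀ`. -/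
lemma Matrix.PosSemidef.exists_eq_mul_transpose {n : ℕ} {C : Matrix (Fin n) (Fin n) ℝ}
    (hC : C.PosSemidef) : ∃ S : Matrix (Fin n) (Fin n) ℝ, C = S * Sᵀ := by
  obtain ⟨B, hB⟩ := CStarAlgebra.nonneg_iff_eq_star_mul_self.mp hC.nonneg
  refine ⟨Bᵀ, ?_⟩
  rw [hB, transpose_transpose, star_eq_conjTranspose, conjTranspose_eq_transpose_of_trivial]

lemma gaussianPdf_zero_one {n : ℕ} (x : Fin n → ℝ) :
    gaussianPdf 0 1 x = ∏ i, gaussianPDFReal 0 1 (x i) := by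
  simp only [gaussianPdf, gaussianPDFReal, Finset.prod_mul_distrib, ← Real.exp_sum, inv_one,
    one_mulVec, dotProduct, sub_zero, Finset.prod_const, Finset.card_univ, Fintype.card_fin,
    det_one, mul_one, NNReal.coe_one, inv_pow, Finset.mul_sum]
  congr 2
  · rw [Real.sqrt_eq_iff_mul_self_eq_of_pos (by positivity), ← mul_pow,
      Real.mul_self_sqrt (by positivity)]
  · exact Finset.sum_congr rfl fun i _ => by ring

lemma measurable_gaussianPdf {n : ℕ} (m : Fin n → ℝ) (C : Matrix (Fin n) (Fin n) ℝ) :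
    Measurable (gaussianPdf m C) := by
  have : Continuous (gaussianPdf m C) := by
    unfold gaussianPdf
    fun_prop
  exact this.measurable

/-- The standard Gaussian measure is the product of one-dimensional standard Gaussians. -/
lemma gaussianMeasure_zero_one (n : ℕ) :
    gaussianMeasure (0 : Fin n → ℝ) 1 = Measure.pi fun _ => gaussianReal 0 1 := by
  symm
  refine Measure.pi_eq fun s hs => ?_
  rw [gaussianMeasure, withDensity_apply _ (MeasurableSet.univ_pi hs), volume_pi,
    Measure.restrict_pi_pi]
  simp_rw [gaussianPdf_zero_one]
  rw [← ofReal_integral_eq_lintegral_ofReal, integral_fintype_prod_eq_prod,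
    ENNReal.ofReal_prod_of_nonneg]
  · exact Finset.prod_congr rfl fun i _ =>
      (gaussianReal_apply_eq_integral 0 one_ne_zero (s i)).symm
  · exact fun i _ => integral_nonneg fun x => gaussianPDFReal_nonneg _ _ _
  · exact Integrable.fintype_prod_dep fun i => (integrable_gaussianPDFReal 0 1).restrict
  · exact ae_of_all _ fun x => Finset.prod_nonneg fun i _ => gaussianPDFReal_nonneg _ _ _

/-- A Gaussian density pulled back along the affine whitening map. -/
lemma abs_det_mul_gaussianPdf_affine {n : ℕ} (m : Fin n → ℝ) {S : Matrix (Fin n) (Fin n) ℝ}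
    (hS : S.det ≠ 0) (z : Fin n → ℝ) :
    |S.det| * gaussianPdf m (S * Sᵀ) (m + S *ᵥ z) = gaussianPdf 0 1 z := by
  have hu : IsUnit S.det := hS.isUnit
  have hq : (S *ᵥ z) ⬝ᵥ ((S * Sᵀ)⁻¹ *ᵥ (S *ᵥ z)) = z ⬝ᵥ z := by
    rw [Matrix.mul_inv_rev, mulVec_mulVec, Matrix.mul_assoc, nonsing_inv_mul _ hu,
      Matrix.mul_one, dotProduct_mulVec, ← vecMul_transpose, vecMul_vecMul,
      mul_nonsing_inv _ (by rwa [det_transpose]), vecMul_one]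
  have hd : Real.sqrt ((2 * Real.pi) ^ n * (S * Sᵀ).det) =
      Real.sqrt ((2 * Real.pi) ^ n) * |S.det| := by
    rw [det_mul, det_transpose, Real.sqrt_mul (by positivity), Real.sqrt_mul_self_eq_abs]
  have ha : |S.det| ≠ 0 := abs_ne_zero.mpr hS
  simp only [gaussianPdf, add_sub_cancel_left, hq, hd, sub_zero, inv_one, one_mulVec, det_one,
    mul_one]
  field_simp

/-- A Gaussian measure is an affine image of the standard Gaussian product measure. -/
lemma gaussianMeasure_eq_map {n : ℕ} (m : Fin n → ℝ) {S : Matrix (Fin n) (Fin n) ℝ}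
    (hS : S.det ≠ 0) :
    gaussianMeasure m (S * Sᵀ) =
      (Measure.pi fun _ => gaussianReal 0 1).map fun z => m + S *ᵥ z := by
  have hcont : Continuous fun z : Fin n → ℝ => m + S *ᵥ z := by fun_prop
  rw [← gaussianMeasure_zero_one]
  refine Measure.ext_of_lintegral _ fun f hf => ?_
  rw [lintegral_map hf hcont.measurable, gaussianMeasure, gaussianMeasure,
    lintegral_withDensity_eq_lintegral_mul _ (measurable_gaussianPdf _ _).ennreal_ofReal hf,
    lintegral_withDensity_eq_lintegral_mul (g := fun z => f (m + S *ᵥ z)) _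
      (measurable_gaussianPdf _ _).ennreal_ofReal (hf.comp hcont.measurable)]
  have hu : IsUnit S := (isUnit_iff_isUnit_det S).mpr hS.isUnit
  have hbij : Function.Bijective fun z : Fin n → ℝ => m + S *ᵥ z :=
    (Equiv.addLeft m).bijective.comp
      ⟨mulVec_injective_of_isUnit hu, mulVec_surjective_iff_isUnit.mpr hu⟩
  have hderiv : ∀ z ∈ Set.univ, HasFDerivWithinAt (fun z : Fin n → ℝ => m + S *ᵥ z)
      (LinearMap.toContinuousLinearMap (toLin' S)) Set.univ z := fun z _ =>
    ((LinearMap.toContinuousLinearMap (toLin' S)).hasFDerivAt.const_add m).hasFDerivWithinAt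
  have key := lintegral_image_eq_lintegral_abs_det_fderiv_mul volume MeasurableSet.univ hderiv
    hbij.injective.injOn ((fun x => ENNReal.ofReal (gaussianPdf m (S * Sᵀ) x)) * f)
  rw [Set.image_univ, hbij.surjective.range_eq, setLIntegral_univ, setLIntegral_univ] at key
  rw [key]
  refine lintegral_congr fun z => ?_
  simp only [Pi.mul_apply, ← mul_assoc]
  rw [← ENNReal.ofReal_mul (abs_nonneg _), LinearMap.det_toContinuousLinearMap,
    LinearMap.det_toLin', abs_det_mul_gaussianPdf_affine m hS]

lemma integrable_prod_pow_stdGaussian {n : ℕ} (a : Fin n → ℕ) :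
    Integrable (fun z : Fin n → ℝ => ∏ k, z k ^ a k) (Measure.pi fun _ => gaussianReal 0 1) := by
  refine Integrable.fintype_prod_dep (f := fun k (t : ℝ) => t ^ a k) fun k => ?_
  exact (memLp_id_gaussianReal (μ := 0) (v := 1) (a k)).integrable_norm_pow' |>.mono'
    (by fun_prop) (by simp)

lemma integral_sq_gaussianReal : ∫ t, t ^ 2 ∂gaussianReal 0 1 = 1 := by
  have h := variance_fun_id_gaussianReal (μ := 0) (v := 1)
  rw [variance_eq_integral (by fun_prop)] at h
  simpa using h

lemma prod_pow_single {n : ℕ} (z : Fin n → ℝ) (i : Fin n) :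
    ∏ k, z k ^ (Pi.single i 1 : Fin n → ℕ) k = z i := by
  rw [Finset.prod_eq_single i (fun k _ hk => by simp [hk]) (by simp)]
  simp

lemma prod_pow_single_add_single {n : ℕ} (z : Fin n → ℝ) (i j : Fin n) :
    ∏ k, z k ^ (Pi.single i 1 + Pi.single j 1 : Fin n → ℕ) k = z i * z j := by
  simp only [Pi.add_apply, pow_add, Finset.prod_mul_distrib, prod_pow_single]

lemma integrable_coord_stdGaussian {n : ℕ} (i : Fin n) :
    Integrable (fun z : Fin n → ℝ => z i) (Measure.pi fun _ => gaussianReal 0 1) := by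
  simpa only [prod_pow_single] using integrable_prod_pow_stdGaussian (Pi.single i 1)

lemma integrable_coord_mul_coord_stdGaussian {n : ℕ} (i j : Fin n) :
    Integrable (fun z : Fin n → ℝ => z i * z j) (Measure.pi fun _ => gaussianReal 0 1) := by
  have h := integrable_prod_pow_stdGaussian (Pi.single i 1 + Pi.single j 1 : Fin n → ℕ)
  exact h.congr (ae_of_all _ fun z => prod_pow_single_add_single z i j)

lemma integral_coord_stdGaussian {n : ℕ} (i : Fin n) :
    ∫ z : Fin n → ℝ, z i ∂(Measure.pi fun _ => gaussianReal 0 1) = 0 := by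
  simp_rw [← prod_pow_single _ i]
  rw [integral_fintype_prod_eq_prod (fun k (t : ℝ) => t ^ (Pi.single i 1 : Fin n → ℕ) k)]
  refine Finset.prod_eq_zero (Finset.mem_univ i) ?_
  simp [integral_id_gaussianReal]

lemma integral_coord_mul_coord_stdGaussian {n : ℕ} (i j : Fin n) :
    ∫ z : Fin n → ℝ, z i * z j ∂(Measure.pi fun _ => gaussianReal 0 1) =
      (1 : Matrix (Fin n) (Fin n) ℝ) i j := by
  simp_rw [← prod_pow_single_add_single _ i j]
  refine (integral_fintype_prod_eq_prod (μ := fun _ : Fin n => gaussianReal 0 1)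
    (fun k (t : ℝ) => t ^ (Pi.single i 1 + Pi.single j 1 : Fin n → ℕ) k)).trans ?_
  by_cases h : i = j
  · subst h
    rw [one_apply_eq]
    refine Finset.prod_eq_one fun k _ => ?_
    by_cases hk : k = i
    · subst hk
      simpa using integral_sq_gaussianReal
    · simp [hk]
  · rw [one_apply_ne h]
    refine Finset.prod_eq_zero (Finset.mem_univ i) ?_
    simp [h, integral_id_gaussianReal]

lemma integrable_integral_quadratic_stdGaussian {n : ℕ} (Q : Matrix (Fin n) (Fin n) ℝ)
    (l : Fin n → ℝ) (c : ℝ) :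
    Integrable (fun z => z ⬝ᵥ (Q *ᵥ z) + l ⬝ᵥ z + c) (Measure.pi fun _ => gaussianReal 0 1) ∧
    ∫ z, z ⬝ᵥ (Q *ᵥ z) + l ⬝ᵥ z + c ∂(Measure.pi fun _ => gaussianReal 0 1) = Q.trace + c := by
  have hrw : ∀ z : Fin n → ℝ, z ⬝ᵥ (Q *ᵥ z) = ∑ i, ∑ j, Q i j * (z i * z j) := fun z => by
    simp only [dotProduct, mulVec, Finset.mul_sum]
    exact Finset.sum_congr rfl fun i _ => Finset.sum_congr rfl fun j _ => by ring
  have hij : ∀ i j, Integrable (fun z : Fin n → ℝ => Q i j * (z i * z j))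
      (Measure.pi fun _ => gaussianReal 0 1) :=
    fun i j => (integrable_coord_mul_coord_stdGaussian i j).const_mul _
  have hi : ∀ i, Integrable (fun z : Fin n → ℝ => ∑ j, Q i j * (z i * z j))
      (Measure.pi fun _ => gaussianReal 0 1) := fun i => integrable_finsetSum _ fun j _ => hij i j
  have hl : ∀ i, Integrable (fun z : Fin n → ℝ => l i * z i)
      (Measure.pi fun _ => gaussianReal 0 1) := fun i => (integrable_coord_stdGaussian i).const_mul _
  have h2 := integrable_finsetSum Finset.univ fun i _ => hi i
  have h1 := integrable_finsetSum Finset.univ fun i _ => hl i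
  simp_rw [hrw]
  simp only [dotProduct]
  refine ⟨(h2.fun_add h1).fun_add (integrable_const c), ?_⟩
  rw [integral_add (h2.fun_add h1) (integrable_const c), integral_add h2 h1,
    integral_finsetSum _ fun i _ => hi i, integral_finsetSum _ fun i _ => hl i]
  simp_rw [integral_finsetSum Finset.univ fun j _ => hij _ j, integral_const_mul,
    integral_coord_mul_coord_stdGaussian, integral_coord_stdGaussian]
  simp [one_apply, trace]

/-- Expectation of a quadratic form of an affine function of a Gaussian vector. -/
lemma integrable_integral_quadratic_gaussianMeasure {n q : ℕ} (m : Fin n → ℝ)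
    {C : Matrix (Fin n) (Fin n) ℝ} (hC : C.PosDef) (A : Matrix (Fin q) (Fin n) ℝ)
    (K : Matrix (Fin q) (Fin q) ℝ) (b : Fin q → ℝ) :
    Integrable (fun x => (A *ᵥ (x - m) + b) ⬝ᵥ (K *ᵥ (A *ᵥ (x - m) + b)))
      (gaussianMeasure m C) ∧
    ∫ x, (A *ᵥ (x - m) + b) ⬝ᵥ (K *ᵥ (A *ᵥ (x - m) + b)) ∂(gaussianMeasure m C) =
      trace (K * A * C * Aᵀ) + b ⬝ᵥ (K *ᵥ b) := by
  obtain ⟨S, rfl⟩ := hC.posSemidef.exists_eq_mul_transpose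
  have hS : S.det ≠ 0 := fun h => by simpa [det_mul, h] using hC.det_pos
  have hφ : AEMeasurable (fun z : Fin n → ℝ => m + S *ᵥ z)
      (Measure.pi fun _ => gaussianReal 0 1) := by fun_prop
  have hf : Continuous fun x : Fin n → ℝ =>
      (A *ᵥ (x - m) + b) ⬝ᵥ (K *ᵥ (A *ᵥ (x - m) + b)) := by fun_prop
  have hexp : ∀ z : Fin n → ℝ,
      (A *ᵥ (m + S *ᵥ z - m) + b) ⬝ᵥ (K *ᵥ (A *ᵥ (m + S *ᵥ z - m) + b)) =
        z ⬝ᵥ (((A * S)ᵀ * K * (A * S)) *ᵥ z) +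
          (b ᵥ* (K * (A * S)) + (A * S)ᵀ *ᵥ (K *ᵥ b)) ⬝ᵥ z + b ⬝ᵥ (K *ᵥ b) := fun z => by
    have h1 : ∀ v : Fin q → ℝ, ((A * S) *ᵥ z) ⬝ᵥ v = z ⬝ᵥ ((A * S)ᵀ *ᵥ v) := fun v => by
      rw [dotProduct_mulVec, vecMul_transpose]
    rw [add_sub_cancel_left, mulVec_mulVec, mulVec_add, add_dotProduct, dotProduct_add,
      dotProduct_add, h1, h1, mulVec_mulVec, mulVec_mulVec, add_dotProduct, ← dotProduct_mulVec,
      ← mulVec_mulVec z K, dotProduct_comm ((A * S)ᵀ *ᵥ (K *ᵥ b)), ← Matrix.mul_assoc]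
    simp only [mulVec_mulVec, ← Matrix.mul_assoc]
    ring
  obtain ⟨hint, hval⟩ := integrable_integral_quadratic_stdGaussian ((A * S)ᵀ * K * (A * S))
    (b ᵥ* (K * (A * S)) + (A * S)ᵀ *ᵥ (K *ᵥ b)) (b ⬝ᵥ (K *ᵥ b))
  rw [gaussianMeasure_eq_map m hS, integrable_map_measure hf.aestronglyMeasurable hφ,
    integral_map hφ hf.aestronglyMeasurable]
  simp only [Function.comp_def, hexp]
  refine ⟨hint, ?_⟩
  rw [hval, Matrix.mul_assoc, trace_mul_comm, transpose_mul]
  simp only [Matrix.mul_assoc]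

lemma isProbabilityMeasure_gaussianMeasure {n : ℕ} (m : Fin n → ℝ)
    {C : Matrix (Fin n) (Fin n) ℝ} (hC : C.PosDef) :
    IsProbabilityMeasure (gaussianMeasure m C) := by
  obtain ⟨S, rfl⟩ := hC.posSemidef.exists_eq_mul_transpose
  have hS : S.det ≠ 0 := fun h => by simpa [det_mul, h] using hC.det_pos
  rw [gaussianMeasure_eq_map m hS]
  exact Measure.isProbabilityMeasure_map (by fun_prop)

lemma log_gaussianPdf_div_gaussianPdf {q : ℕ} (m₀ m₁ : Fin q → ℝ)
    {C₀ C₁ : Matrix (Fin q) (Fin q) ℝ} (h₀ : C₀.PosDef) (h₁ : C₁.PosDef) (x : Fin q → ℝ) :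
    Real.log (gaussianPdf m₀ C₀ x / gaussianPdf m₁ C₁ x) =
      -(1 / 2) * Real.log (C₀ * C₁⁻¹).det +
        (-(1 / 2) * ((x - m₀) ⬝ᵥ (C₀⁻¹ *ᵥ (x - m₀))) +
          1 / 2 * ((x - m₁) ⬝ᵥ (C₁⁻¹ *ᵥ (x - m₁)))) := by
  have d₀ := h₀.det_pos
  have d₁ := h₁.det_pos
  have hp : 0 < (2 * Real.pi) ^ q := by positivity
  rw [det_mul, det_nonsing_inv, Ring.inverse_eq_inv', gaussianPdf, gaussianPdf,
    Real.log_div (by positivity) (by positivity),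
    Real.log_mul (by positivity) (by positivity), Real.log_mul (by positivity) (by positivity),
    Real.log_exp, Real.log_exp, Real.log_inv, Real.log_inv, Real.log_sqrt (by positivity),
    Real.log_sqrt (by positivity), Real.log_mul (by positivity) (by positivity),
    Real.log_mul (by positivity) (by positivity), Real.log_mul (by positivity) (by positivity),
    Real.log_inv]
  ring

/-- Closed form of the Kullback-Leibler divergence between two Gaussians. -/
lemma gaussianKLDiv_eq {q : ℕ} (m₀ m₁ : Fin q → ℝ)
    {C₀ C₁ : Matrix (Fin q) (Fin q) ℝ} (h₀ : C₀.PosDef) (h₁ : C₁.PosDef) :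
    gaussianKLDiv m₀ m₁ C₀ C₁ =
      1 / 2 * (trace (C₀ * C₁⁻¹) - Real.log (C₀ * C₁⁻¹).det - q) +
        1 / 2 * ((m₀ - m₁) ⬝ᵥ (C₁⁻¹ *ᵥ (m₀ - m₁))) := by
  have := isProbabilityMeasure_gaussianMeasure m₀ h₀
  obtain ⟨i₀, e₀⟩ := integrable_integral_quadratic_gaussianMeasure m₀ h₀ 1 C₀⁻¹ 0
  obtain ⟨i₁, e₁⟩ := integrable_integral_quadratic_gaussianMeasure m₀ h₀ 1 C₁⁻¹ (m₀ - m₁)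
  simp only [one_mulVec, add_zero, sub_add_sub_cancel, Matrix.mul_one, transpose_one,
    zero_dotProduct] at i₀ e₀ i₁ e₁
  rw [nonsing_inv_mul _ h₀.det_pos.ne'.isUnit, trace_one, Fintype.card_fin] at e₀
  simp_rw [gaussianKLDiv, log_gaussianPdf_div_gaussianPdf m₀ m₁ h₀ h₁]
  rw [integral_add (integrable_const _) ((i₀.const_mul _).fun_add (i₁.const_mul _)),
    integral_add (i₀.const_mul _) (i₁.const_mul _), integral_const_mul, integral_const_mul,
    integral_const_mul, e₀, e₁, integral_const, probReal_univ, one_smul, trace_mul_comm C₁⁻¹]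
  ring

/-- Proposition 3.4: closed form of the expected Kullback-Leibler divergence
between the posterior distributions of the full and reduced linear Gaussian
models, with affine posterior means `m*(y) = G*(y − m_Y) + h*` and
`m_V(y) = G_V Vᵀ(y − m_Y) + h_V`. -/
theorem stmt_9 {q n r : ℕ}
    (Cs CV : Matrix (Fin q) (Fin q) ℝ) (hCs : Cs.PosDef) (hCV : CV.PosDef)
    (CY : Matrix (Fin n) (Fin n) ℝ) (hCY : CY.PosDef) (mY : Fin n → ℝ)
    (Gs : Matrix (Fin q) (Fin n) ℝ) (GV : Matrix (Fin q) (Fin r) ℝ)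
    (V : Matrix (Fin n) (Fin r) ℝ) (hs hV : Fin q → ℝ) :
    ∫ y, gaussianKLDiv (Gs *ᵥ (y - mY) + hs) ((GV * Vᵀ) *ᵥ (y - mY) + hV) Cs CV
        ∂(gaussianMeasure mY CY) =
      (1 / 2) * (Matrix.trace (Cs * CV⁻¹) - Real.log (Cs * CV⁻¹).det - q +
        Matrix.trace (CV⁻¹ * (Gs - GV * Vᵀ) * CY * (Gs - GV * Vᵀ)ᵀ) +
        (hs - hV) ⬝ᵥ (CV⁻¹ *ᵥ (hs - hV))) := by
  have := isProbabilityMeasure_gaussianMeasure mY hCY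
  obtain ⟨hint, hval⟩ := integrable_integral_quadratic_gaussianMeasure mY hCY (Gs - GV * Vᵀ)
    CV⁻¹ (hs - hV)
  have hdiff : ∀ y, Gs *ᵥ (y - mY) + hs - ((GV * Vᵀ) *ᵥ (y - mY) + hV) =
      (Gs - GV * Vᵀ) *ᵥ (y - mY) + (hs - hV) := fun y => by
    rw [sub_mulVec, add_sub_add_comm]
  simp_rw [gaussianKLDiv_eq _ _ hCs hCV, hdiff]
  rw [integral_add (integrable_const _) (hint.const_mul _), integral_const_mul, integral_const_mul,
    hval, integral_const, probReal_univ, one_smul]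
  ring
end

section
/- Let C_X ∈ ℝ^{q×q} and C_E ∈ ℝ^{n×n} be symmetric positive definite, B ∈ ℝ^{n×q}, C_Y = B C_X Bᵀ + C_E, y ∈ ℝ^n, m_X ∈ ℝ^q, m_E ∈ ℝ^n, m_Y = B m_X + m_E, and fix 1 ≤ r ≤ n. For each full-column-rank V ∈ ℝ^{n×r}, let C_V = C_X − C_X Bᵀ V (Vᵀ C_Y V)⁻¹ Vᵀ B C_X and m_V = C_X Bᵀ V (Vᵀ C_Y V)⁻¹ Vᵀ(y − m_Y) + C_V C_X⁻¹ m_X + C_X Bᵀ V (Vᵀ C_Y V)⁻¹ Vᵀ B m_X, and let m*, C* be the corresponding quantities for the full model (V = I_n). Define J₀(V) = ½( trace(C* C_V⁻¹) − log det(C* C_V⁻¹) − q + (m* − m_V)ᵀ C_V⁻¹ (m* − m_V) ). Then there exists a full-column-rank V₀ ∈ ℝ^{n×r} such that J₀(V₀) ≤ J₀(V) for every full-column-rank V ∈ ℝ^{n×r}. -/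
open Matrix

/-- Reduced posterior covariance `C_V = C_X − C_X Bᵀ V (Vᵀ C_Y V)⁻¹ Vᵀ B C_X`. -/
noncomputable def redCov {q n r : ℕ} (CX : Matrix (Fin q) (Fin q) ℝ)
    (CY : Matrix (Fin n) (Fin n) ℝ) (B : Matrix (Fin n) (Fin q) ℝ)
    (V : Matrix (Fin n) (Fin r) ℝ) : Matrix (Fin q) (Fin q) ℝ :=
  CX - CX * Bᵀ * V * (Vᵀ * CY * V)⁻¹ * Vᵀ * B * CX

/-- Reduced posterior mean
`m_V = C_X Bᵀ V (Vᵀ C_Y V)⁻¹ Vᵀ (y − m_Y) + C_V C_X⁻¹ m_X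
       + C_X Bᵀ V (Vᵀ C_Y V)⁻¹ Vᵀ B m_X`. -/
noncomputable def redMean {q n r : ℕ} (CX : Matrix (Fin q) (Fin q) ℝ)
    (CY : Matrix (Fin n) (Fin n) ℝ) (B : Matrix (Fin n) (Fin q) ℝ)
    (mX : Fin q → ℝ) (mY y : Fin n → ℝ)
    (V : Matrix (Fin n) (Fin r) ℝ) : Fin q → ℝ :=
  (CX * Bᵀ * V * (Vᵀ * CY * V)⁻¹ * Vᵀ) *ᵥ (y - mY) +
    redCov CX CY B V *ᵥ (CX⁻¹ *ᵥ mX) +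
    (CX * Bᵀ * V * (Vᵀ * CY * V)⁻¹ * Vᵀ) *ᵥ (B *ᵥ mX)

/-- The Kullback-Leibler divergence `J₀(V)` between the posterior distributions
of the full model (`V = I_n`) and the reduced model, in closed form. -/
noncomputable def J₀ {q n r : ℕ} (CX : Matrix (Fin q) (Fin q) ℝ)
    (CY : Matrix (Fin n) (Fin n) ℝ) (B : Matrix (Fin n) (Fin q) ℝ)
    (mX : Fin q → ℝ) (mY y : Fin n → ℝ)
    (V : Matrix (Fin n) (Fin r) ℝ) : ℝ :=
  (1 / 2) * (Matrix.trace (redCov CX CY B (1 : Matrix (Fin n) (Fin n) ℝ) *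
      (redCov CX CY B V)⁻¹) -
    Real.log (redCov CX CY B (1 : Matrix (Fin n) (Fin n) ℝ) *
      (redCov CX CY B V)⁻¹).det - q +
    (redMean CX CY B mX mY y (1 : Matrix (Fin n) (Fin n) ℝ) - redMean CX CY B mX mY y V) ⬝ᵥ
      ((redCov CX CY B V)⁻¹ *ᵥ
        (redMean CX CY B mX mY y (1 : Matrix (Fin n) (Fin n) ℝ) - redMean CX CY B mX mY y V)))

namespace Matrix

theorem isUnit_transpose_mul_self_of_rank_eq {n r : ℕ} {V : Matrix (Fin n) (Fin r) ℝ}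
    (hV : V.rank = r) : IsUnit (Vᵀ * V) := by
  have hli : LinearIndependent ℝ (Vᵀ * V).col := by
    rw [linearIndependent_iff_card_eq_finrank_span, Fintype.card_fin, Set.finrank,
      ← rank_eq_finrank_span_cols, rank_transpose_mul_self, hV]
  exact linearIndependent_cols_iff_isUnit.mp hli

theorem mulVec_injective_of_isUnit_transpose_mul_self {n r : ℕ} {V : Matrix (Fin n) (Fin r) ℝ}
    (hV : IsUnit (Vᵀ * V)) : Function.Injective V.mulVec := by
  intro x z hxz
  apply mulVec_injective_of_isUnit hV
  simp only [← mulVec_mulVec]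
  exact congrArg (Vᵀ *ᵥ ·) hxz

theorem PosDef.transpose_mul_mul_same {m n : ℕ} {A : Matrix (Fin n) (Fin n) ℝ} (hA : A.PosDef)
    {V : Matrix (Fin n) (Fin m) ℝ} (hV : Function.Injective V.mulVec) :
    (Vᵀ * A * V).PosDef := by
  simpa only [conjTranspose_eq_transpose_of_trivial] using hA.conjTranspose_mul_mul_same hV

open scoped MatrixOrder Matrix.Norms.L2Operator in
theorem PosDef.exists_isUnit_eq_transpose_mul_self {r : ℕ} {A : Matrix (Fin r) (Fin r) ℝ}
    (hA : A.PosDef) : ∃ R : Matrix (Fin r) (Fin r) ℝ, IsUnit R ∧ A = Rᵀ * R := by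
  obtain ⟨R, hR, h⟩ := CStarAlgebra.isStrictlyPositive_iff_eq_star_mul_self.mp
    hA.isStrictlyPositive
  exact ⟨R, hR, by simpa [star_eq_conjTranspose] using h⟩

/-- A matrix of full column rank can be orthonormalized by an invertible right factor. -/
theorem exists_isUnit_orthonormal_mul {n r : ℕ} {V : Matrix (Fin n) (Fin r) ℝ}
    (hV : V.rank = r) :
    ∃ M : Matrix (Fin r) (Fin r) ℝ, IsUnit M ∧ (V * M)ᵀ * (V * M) = 1 := by
  have hinj := mulVec_injective_of_isUnit_transpose_mul_self
    (isUnit_transpose_mul_self_of_rank_eq hV)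
  have hpd : (Vᵀ * V).PosDef := by simpa using PosDef.transpose_mul_mul_same PosDef.one hinj
  obtain ⟨R, hR, h⟩ := hpd.exists_isUnit_eq_transpose_mul_self
  have hdet := (isUnit_iff_isUnit_det R).mp hR
  have hdet' : IsUnit (Rᵀ).det := by rwa [det_transpose]
  refine ⟨R⁻¹, (isUnit_nonsing_inv_iff).mpr hR, ?_⟩
  calc (V * R⁻¹)ᵀ * (V * R⁻¹) = (R⁻¹)ᵀ * (Vᵀ * V) * R⁻¹ := by
        simp only [transpose_mul, Matrix.mul_assoc]
    _ = ((Rᵀ)⁻¹ * Rᵀ) * (R * R⁻¹) := by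
        rw [h, transpose_nonsing_inv]; simp only [Matrix.mul_assoc]
    _ = 1 := by rw [nonsing_inv_mul _ hdet', mul_nonsing_inv _ hdet, Matrix.one_mul]

theorem rank_eq_of_transpose_mul_self_eq_one {n r : ℕ} {V : Matrix (Fin n) (Fin r) ℝ}
    (hV : Vᵀ * V = 1) : V.rank = r := by
  rw [← rank_transpose_mul_self, hV, rank_one, Fintype.card_fin]

theorem isCompact_setOf_transpose_mul_self_eq_one (n r : ℕ) :
    IsCompact {V : Matrix (Fin n) (Fin r) ℝ | Vᵀ * V = 1} := by
  have hbox : IsCompact (Set.univ.pi fun _ : Fin n => Set.univ.pi fun _ : Fin r =>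
      Set.Icc (-1 : ℝ) 1) :=
    isCompact_univ_pi fun _ => isCompact_univ_pi fun _ => isCompact_Icc
  refine hbox.of_isClosed_subset (isClosed_eq (by fun_prop) continuous_const) ?_
  intro (V : Matrix (Fin n) (Fin r) ℝ) (hV : Vᵀ * V = 1) i _ j _
  have hsum : ∑ k, V k j * V k j = 1 := by
    rw [← one_apply_eq (α := ℝ) j, ← hV, mul_apply]
    simp only [transpose_apply]
  have hle : V i j * V i j ≤ 1 := hsum ▸
    Finset.single_le_sum (f := fun k => V k j * V k j) (fun k _ => mul_self_nonneg _)
      (Finset.mem_univ i)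
  exact abs_le.mp ((sq_le_one_iff_abs_le_one _).mp (by rwa [sq]))

theorem exists_transpose_mul_self_eq_one {n r : ℕ} (hrn : r ≤ n) :
    ∃ V : Matrix (Fin n) (Fin r) ℝ, Vᵀ * V = 1 := by
  refine ⟨(1 : Matrix (Fin n) (Fin n) ℝ).submatrix id (Fin.castLE hrn), ?_⟩
  rw [transpose_submatrix, transpose_one, ← submatrix_mul _ _ _ _ _ Function.bijective_id,
    Matrix.mul_one, submatrix_one _ (Fin.castLE_injective hrn)]

theorem _root_.ContinuousOn.matrix_inv {X : Type*} [TopologicalSpace X] {m : ℕ} {s : Set X}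
    {f : X → Matrix (Fin m) (Fin m) ℝ} (hf : ContinuousOn f s) (h : ∀ x ∈ s, IsUnit (f x)) :
    ContinuousOn (fun x => (f x)⁻¹) s := by
  intro x hx
  refine (continuousAt_matrix_inv (f x) ?_).comp_continuousWithinAt (hf x hx)
  rw [Ring.inverse_eq_inv']
  exact continuousAt_inv₀ ((isUnit_iff_isUnit_det _).mp (h x hx)).ne_zero

end Matrix

/-- The matrix `V (Vᵀ C_Y V)⁻¹ Vᵀ`, through which `J₀` depends on `V`. -/
noncomputable def redPrecision {n r : ℕ} (CY : Matrix (Fin n) (Fin n) ℝ)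
    (V : Matrix (Fin n) (Fin r) ℝ) : Matrix (Fin n) (Fin n) ℝ :=
  V * (Vᵀ * CY * V)⁻¹ * Vᵀ

theorem redPrecision_mul_of_isUnit {n r : ℕ} (CY : Matrix (Fin n) (Fin n) ℝ)
    (V : Matrix (Fin n) (Fin r) ℝ) {M : Matrix (Fin r) (Fin r) ℝ} (hM : IsUnit M) :
    redPrecision CY (V * M) = redPrecision CY V := by
  have hdet := (isUnit_iff_isUnit_det M).mp hM
  have hdet' : IsUnit (Mᵀ).det := by rwa [det_transpose]
  have hmid : (V * M)ᵀ * CY * (V * M) = Mᵀ * (Vᵀ * CY * V) * M := by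
    simp only [transpose_mul, Matrix.mul_assoc]
  calc redPrecision CY (V * M)
      = V * (M * M⁻¹) * (Vᵀ * CY * V)⁻¹ * ((Mᵀ)⁻¹ * Mᵀ) * Vᵀ := by
        rw [redPrecision, hmid, Matrix.mul_inv_rev, Matrix.mul_inv_rev, transpose_mul]
        simp only [Matrix.mul_assoc]
    _ = redPrecision CY V := by
        rw [nonsing_inv_mul _ hdet', mul_nonsing_inv _ hdet, Matrix.mul_one, Matrix.mul_one,
          redPrecision]

theorem redCov_eq {q n r : ℕ} (CX : Matrix (Fin q) (Fin q) ℝ)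
    (CY : Matrix (Fin n) (Fin n) ℝ) (B : Matrix (Fin n) (Fin q) ℝ)
    (V : Matrix (Fin n) (Fin r) ℝ) :
    redCov CX CY B V = CX - CX * Bᵀ * redPrecision CY V * B * CX := by
  simp only [redCov, redPrecision, Matrix.mul_assoc]

theorem redMean_eq {q n r : ℕ} (CX : Matrix (Fin q) (Fin q) ℝ)
    (CY : Matrix (Fin n) (Fin n) ℝ) (B : Matrix (Fin n) (Fin q) ℝ)
    (mX : Fin q → ℝ) (mY y : Fin n → ℝ) (V : Matrix (Fin n) (Fin r) ℝ) :
    redMean CX CY B mX mY y V = (CX * Bᵀ * redPrecision CY V) *ᵥ (y - mY) +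
      redCov CX CY B V *ᵥ (CX⁻¹ *ᵥ mX) + (CX * Bᵀ * redPrecision CY V) *ᵥ (B *ᵥ mX) := by
  simp only [redMean, redPrecision, Matrix.mul_assoc]

/-- `J₀` is invariant under invertible right factors. -/
theorem J₀_mul_of_isUnit {q n r : ℕ} (CX : Matrix (Fin q) (Fin q) ℝ)
    (CY : Matrix (Fin n) (Fin n) ℝ) (B : Matrix (Fin n) (Fin q) ℝ)
    (mX : Fin q → ℝ) (mY y : Fin n → ℝ) (V : Matrix (Fin n) (Fin r) ℝ)
    {M : Matrix (Fin r) (Fin r) ℝ} (hM : IsUnit M) :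
    J₀ CX CY B mX mY y (V * M) = J₀ CX CY B mX mY y V := by
  simp only [J₀, redMean_eq, redCov_eq, redPrecision_mul_of_isUnit CY V hM]

/-- The reduced posterior covariance is invertible, by the Woodbury identity. -/
theorem isUnit_redCov {q n r : ℕ} {CX : Matrix (Fin q) (Fin q) ℝ}
    {CE : Matrix (Fin n) (Fin n) ℝ} (hCX : CX.PosDef) (hCE : CE.PosDef)
    (B : Matrix (Fin n) (Fin q) ℝ) {V : Matrix (Fin n) (Fin r) ℝ}
    (hV : Function.Injective V.mulVec) : IsUnit (redCov CX (B * CX * Bᵀ + CE) B V) := by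
  have hS : (Vᵀ * CE * V).PosDef := hCE.transpose_mul_mul_same hV
  have hC : (Vᵀ * (B * CX * Bᵀ + CE) * V).PosDef := by
    refine PosDef.transpose_mul_mul_same (hCE.posSemidef_add ?_) hV
    simpa only [conjTranspose_eq_transpose_of_trivial] using
      hCX.posSemidef.mul_mul_conjTranspose_same B
  have hP : (CX⁻¹ + (Vᵀ * B)ᵀ * (Vᵀ * CE * V)⁻¹ * (Vᵀ * B)).PosDef := by
    refine hCX.inv.add_posSemidef ?_
    simpa only [conjTranspose_eq_transpose_of_trivial] using
      hS.inv.posSemidef.conjTranspose_mul_mul_same (Vᵀ * B)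
  have hCXdet := (isUnit_iff_isUnit_det CX).mp hCX.isUnit
  have hSdet := (isUnit_iff_isUnit_det _).mp hS.isUnit
  have hmid : ((Vᵀ * CE * V)⁻¹)⁻¹ + Vᵀ * B * (CX⁻¹)⁻¹ * (Vᵀ * B)ᵀ =
      Vᵀ * (B * CX * Bᵀ + CE) * V := by
    rw [nonsing_inv_nonsing_inv _ hCXdet, nonsing_inv_nonsing_inv _ hSdet]
    simp only [transpose_mul, transpose_transpose, Matrix.mul_add, Matrix.add_mul,
      Matrix.mul_assoc]
    rw [add_comm]
  have hW := add_mul_mul_inv_eq_sub (A := CX⁻¹) (U := (Vᵀ * B)ᵀ) (C := (Vᵀ * CE * V)⁻¹)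
    (V := Vᵀ * B) hCX.inv.isUnit hS.inv.isUnit (hmid ▸ hC.isUnit)
  have heq : redCov CX (B * CX * Bᵀ + CE) B V =
      (CX⁻¹ + (Vᵀ * B)ᵀ * (Vᵀ * CE * V)⁻¹ * (Vᵀ * B))⁻¹ := by
    rw [hW, hmid, nonsing_inv_nonsing_inv _ hCXdet]
    simp only [redCov, transpose_mul, transpose_transpose, Matrix.mul_assoc]
  rw [heq]
  exact hP.inv.isUnit

theorem continuousOn_J₀ {q n r : ℕ} {CX : Matrix (Fin q) (Fin q) ℝ}
    {CE : Matrix (Fin n) (Fin n) ℝ} (hCX : CX.PosDef) (hCE : CE.PosDef)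
    (B : Matrix (Fin n) (Fin q) ℝ) (mX : Fin q → ℝ) (mY y : Fin n → ℝ) :
    ContinuousOn (J₀ (r := r) CX (B * CX * Bᵀ + CE) B mX mY y)
      {V | Function.Injective V.mulVec} := by
  have hCY : (B * CX * Bᵀ + CE).PosDef := by
    refine hCE.posSemidef_add ?_
    simpa only [conjTranspose_eq_transpose_of_trivial] using
      hCX.posSemidef.mul_mul_conjTranspose_same B
  have hG : ContinuousOn (redPrecision (r := r) (B * CX * Bᵀ + CE))
      {V | Function.Injective V.mulVec} := by
    have hinv : ContinuousOn (fun V : Matrix (Fin n) (Fin r) ℝ =>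
        (Vᵀ * (B * CX * Bᵀ + CE) * V)⁻¹) {V | Function.Injective V.mulVec} :=
      ContinuousOn.matrix_inv (Continuous.continuousOn (by fun_prop))
        fun V hV => (hCY.transpose_mul_mul_same hV).isUnit
    unfold redPrecision
    rw [continuousOn_iff_continuous_domRestrict] at hinv ⊢
    exact (continuous_subtype_val.matrix_mul hinv).matrix_mul
      continuous_subtype_val.matrix_transpose
  have hcov : ContinuousOn (redCov (r := r) CX (B * CX * Bᵀ + CE) B)
      {V | Function.Injective V.mulVec} := by
    rw [continuousOn_iff_continuous_domRestrict] at hG ⊢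
    refine Continuous.congr ?_ fun V => (redCov_eq CX _ B V.1).symm
    exact continuous_const.sub (((continuous_const.matrix_mul hG).matrix_mul
      continuous_const).matrix_mul continuous_const)
  have hcovinv := hcov.matrix_inv fun V hV => isUnit_redCov hCX hCE B hV
  have hmean : ContinuousOn (redMean (r := r) CX (B * CX * Bᵀ + CE) B mX mY y)
      {V | Function.Injective V.mulVec} := by
    rw [continuousOn_iff_continuous_domRestrict] at hG hcov ⊢
    refine Continuous.congr ?_ fun V => (redMean_eq CX _ B mX mY y V.1).symm
    have hgain := (continuous_const (y := CX * Bᵀ)).matrix_mul hG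
    exact ((hgain.matrix_mulVec continuous_const).add
      (hcov.matrix_mulVec continuous_const)).add (hgain.matrix_mulVec continuous_const)
  have hdet : ∀ V ∈ {V : Matrix (Fin n) (Fin r) ℝ | Function.Injective V.mulVec},
      (redCov CX (B * CX * Bᵀ + CE) B (1 : Matrix (Fin n) (Fin n) ℝ) *
        (redCov CX (B * CX * Bᵀ + CE) B V)⁻¹).det ≠ 0 := fun V hV =>
    ((isUnit_iff_isUnit_det _).mp ((isUnit_redCov hCX hCE B
      (mulVec_injective_of_isUnit isUnit_one)).mul
        (isUnit_nonsing_inv_iff.mpr (isUnit_redCov hCX hCE B hV)))).ne_zero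
  unfold J₀
  rw [continuousOn_iff_continuous_domRestrict] at hcovinv hmean ⊢
  have hprod := (continuous_const (y := redCov CX (B * CX * Bᵀ + CE) B
    (1 : Matrix (Fin n) (Fin n) ℝ))).matrix_mul hcovinv
  have hdiff := (continuous_const (y := redMean CX (B * CX * Bᵀ + CE) B mX mY y
    (1 : Matrix (Fin n) (Fin n) ℝ))).sub hmean
  exact continuous_const.mul (((hprod.matrix_trace.sub
    (hprod.matrix_det.log fun V => hdet V.1 V.2)).sub continuous_const).add
      (hdiff.dotProduct (hcovinv.matrix_mulVec hdiff)))

/-- Theorem 3.2: the Kullback-Leibler divergence `J₀` attains its minimum over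
the set of full-column-rank matrices `V ∈ ℝ^{n×r}`. -/
theorem stmt_10 {q n r : ℕ} (hr : 1 ≤ r) (hrn : r ≤ n)
    (CX : Matrix (Fin q) (Fin q) ℝ) (CE : Matrix (Fin n) (Fin n) ℝ)
    (hCX : CX.PosDef) (hCE : CE.PosDef)
    (B : Matrix (Fin n) (Fin q) ℝ)
    (CY : Matrix (Fin n) (Fin n) ℝ) (hCY : CY = B * CX * Bᵀ + CE)
    (mX : Fin q → ℝ) (mE : Fin n → ℝ) (mY : Fin n → ℝ) (hmY : mY = B *ᵥ mX + mE)
    (y : Fin n → ℝ) :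
    ∃ V₀ : Matrix (Fin n) (Fin r) ℝ, V₀.rank = r ∧
      ∀ V : Matrix (Fin n) (Fin r) ℝ, V.rank = r →
        J₀ CX CY B mX mY y V₀ ≤ J₀ CX CY B mX mY y V := by
  subst hCY
  obtain ⟨V₀, hV₀, hmin⟩ := (isCompact_setOf_transpose_mul_self_eq_one n r).exists_isMinOn
    (exists_transpose_mul_self_eq_one hrn)
    ((continuousOn_J₀ hCX hCE B mX mY y).mono fun V (hV : Vᵀ * V = 1) =>
      mulVec_injective_of_isUnit_transpose_mul_self (hV ▸ isUnit_one))
  refine ⟨V₀, rank_eq_of_transpose_mul_self_eq_one hV₀, fun V hV => ?_⟩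
  obtain ⟨M, hM, hVM⟩ := exists_isUnit_orthonormal_mul hV
  rw [← J₀_mul_of_isUnit CX _ B mX mY y V hM]
  exact hmin hVM
end

section
/- Let C_E, C_Y ∈ ℝ^{n×n} be symmetric positive definite, 1 ≤ r ≤ n, and let u₁, …, u_r ∈ ℝ^n be orthonormal eigenvectors of K = C_E^{-1/2} C_Y C_E^{-1/2} associated with its r largest eigenvalues λ₁ ≥ … ≥ λ_r. Let V ∈ ℝ^{n×r} be the matrix with columns vᵢ = C_E^{-1/2} uᵢ (so C_Y vᵢ = λᵢ C_E vᵢ). Then V has full column rank and ½ log det( (Vᵀ C_Y V)(Vᵀ C_E V)⁻¹ ) = ½ ∑_{i=1}^r log λᵢ; that is, this V achieves the maximum of the mutual information I(W, X) over all full-column-rank matrices in ℝ^{n×r}. -/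
open Matrix

/-- Weighted Cauchy–Binet formula, summed over all index functions rather than over subsets. -/
theorem Matrix.factorial_mul_det_transpose_mul_diagonal_mul {R m n : Type*} [CommRing R]
    [Fintype m] [DecidableEq m] [Fintype n] [DecidableEq n] (W : Matrix m n R) (d : m → R) :
    ((Fintype.card n).factorial : R) * (Wᵀ * diagonal d * W).det =
      ∑ f : n → m, (∏ i, d (f i)) * (W.submatrix f id).det ^ 2 := by
  have expand : (Wᵀ * diagonal d * W).det =
      ∑ f : n → m, (∏ i, d (f i)) * (∏ i, W (f i) i) * (W.submatrix f id).det := by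
    have rows : Wᵀ * diagonal d * W =
        fun i => ∑ k, (d k * W k i) • W k := by
      ext i j
      rw [mul_apply, Finset.sum_apply]
      refine Finset.sum_congr rfl fun k _ => ?_
      simp [mul_diagonal, mul_comm]
    rw [rows]
    change (detRowAlternating (R := R) (n := n)).toMultilinearMap _ = _
    rw [MultilinearMap.map_sum]
    refine Finset.sum_congr rfl fun f _ => ?_
    rw [MultilinearMap.map_smul_univ, Finset.prod_mul_distrib]
    rfl
  have reindex (σ : Equiv.Perm n) : (Wᵀ * diagonal d * W).det =
      ∑ f : n → m, (∏ i, d (f i)) * (W.submatrix f id).det *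
        ((Equiv.Perm.sign σ : ℤ) * ∏ i, W (f (σ i)) i) := by
    rw [expand, ← (Equiv.arrowCongr σ.symm (Equiv.refl m)).sum_comp]
    refine Finset.sum_congr rfl fun f _ => ?_
    have hdet : (W.submatrix (f ∘ σ) id).det =
        (Equiv.Perm.sign σ : ℤ) * (W.submatrix f id).det :=
      det_permute σ (W.submatrix f id)
    have hprod : ∏ i, d (f (σ i)) = ∏ i, d (f i) := Equiv.prod_comp σ fun i => d (f i)
    change (∏ i, d (f (σ i))) * (∏ i, W (f (σ i)) i) * (W.submatrix (f ∘ σ) id).det = _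
    rw [hdet, hprod]
    ring
  calc ((Fintype.card n).factorial : R) * (Wᵀ * diagonal d * W).det
      = ∑ _σ : Equiv.Perm n, (Wᵀ * diagonal d * W).det := by
        simp [Fintype.card_perm]
    _ = ∑ σ : Equiv.Perm n, ∑ f : n → m, (∏ i, d (f i)) * (W.submatrix f id).det *
        ((Equiv.Perm.sign σ : ℤ) * ∏ i, W (f (σ i)) i) :=
        Finset.sum_congr rfl fun σ _ => reindex σ
    _ = _ := by
        rw [Finset.sum_comm]
        refine Finset.sum_congr rfl fun f _ => ?_
        rw [← Finset.mul_sum, sq, ← mul_assoc]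
        congr 1
        exact (det_apply' (W.submatrix f id)).symm

/-- Among products of `r` distinct terms of a nonnegative antitone family, the product of the
first `r` terms is the largest. -/
theorem Antitone.prod_comp_le_prod_castLE {n r : ℕ} (hrn : r ≤ n) {d : Fin n → ℝ}
    (hd : Antitone d) (hd0 : ∀ i, 0 ≤ d i) {f : Fin r → Fin n} (hf : Function.Injective f) :
    ∏ i, d (f i) ≤ ∏ i, d (Fin.castLE hrn i) := by
  have hmono : StrictMono (f ∘ Tuple.sort f) :=
    (Tuple.monotone_sort f).strictMono_of_injective (hf.comp (Tuple.sort f).injective)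
  have hle (k : ℕ) (hk : k < r) : k ≤ ((f ∘ Tuple.sort f) ⟨k, hk⟩ : ℕ) := by
    induction k with
    | zero => exact Nat.zero_le _
    | succ k ih =>
      have hlt : (f ∘ Tuple.sort f) ⟨k, by lia⟩ < (f ∘ Tuple.sort f) ⟨k + 1, hk⟩ :=
        hmono (Fin.mk_lt_mk.2 k.lt_succ_self)
      have := ih (by lia)
      rw [Fin.lt_def] at hlt
      lia
  rw [← Equiv.prod_comp (Tuple.sort f) fun i => d (f i)]
  exact Finset.prod_le_prod (fun i _ => hd0 _) fun i _ => hd (Fin.le_def.2 (hle i i.2))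

theorem Matrix.det_transpose_mul_diagonal_mul_le {n r : ℕ} (hrn : r ≤ n) {d : Fin n → ℝ}
    (hd : Antitone d) (hd0 : ∀ i, 0 ≤ d i) (W : Matrix (Fin n) (Fin r) ℝ) :
    (Wᵀ * diagonal d * W).det ≤ (∏ i, d (Fin.castLE hrn i)) * (Wᵀ * W).det := by
  have hd_binet := factorial_mul_det_transpose_mul_diagonal_mul W d
  have hone_binet := factorial_mul_det_transpose_mul_diagonal_mul W 1
  simp only [diagonal_one', Matrix.mul_one, Pi.one_apply, Finset.prod_const_one,
    one_mul] at hone_binet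
  have hfac : (0 : ℝ) < (Fintype.card (Fin r)).factorial := by positivity
  refine le_of_mul_le_mul_left ?_ hfac
  rw [hd_binet, mul_left_comm, hone_binet, Finset.mul_sum]
  refine Finset.sum_le_sum fun f _ => ?_
  by_cases hf : Function.Injective f
  · exact mul_le_mul_of_nonneg_right (hd.prod_comp_le_prod_castLE hrn hd0 hf) (sq_nonneg _)
  · obtain ⟨i, j, hij, hne⟩ : ∃ i j, f i = f j ∧ i ≠ j := by
      simpa [Function.Injective] using hf
    have hdet : (W.submatrix f id).det = 0 :=
      det_zero_of_row_eq hne (by ext k; simp [hij])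
    simp [hdet]

theorem Matrix.mulVec_injective_of_rank_eq {K : Type*} [Field K] {m n : Type*} [Fintype n]
    {A : Matrix m n K} (hA : A.rank = Fintype.card n) : Function.Injective A.mulVec := by
  have h := A.mulVecLin.finrank_range_add_finrank_ker
  rw [Module.finrank_fintype_fun_eq_card] at h
  have hrange : Module.finrank K A.mulVecLin.range = Fintype.card n := hA
  have hker : Module.finrank K A.mulVecLin.ker = 0 := by lia
  exact LinearMap.ker_eq_bot.1 (Submodule.finrank_eq_zero.1 hker)

/-- Theorem 3.6 (attainment): with `λ₁ ≥ … ≥ λₙ` the eigenvalues of the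
generalized eigenvalue problem `C_Y v = λ C_E v`, encoded by a
`C_E`-orthonormal eigenbasis `P` (`Pᵀ C_E P = I`, `C_Y P = C_E P diag(λ)`),
the matrix `V` made of the first `r` columns of `P` (the generalized
eigenvectors of the `r` dominant eigenvalues) has full column rank and
achieves the maximum of the mutual information:
`½ log det((Vᵀ C_Y V)(Vᵀ C_E V)⁻¹) = ½ ∑_{i=1}^r log λᵢ`, which bounds from
above the value at every full-column-rank matrix. -/
theorem stmt_13 {n r : ℕ} (hr : 1 ≤ r) (hrn : r ≤ n)
    (CE CY : Matrix (Fin n) (Fin n) ℝ) (hCE : CE.PosDef) (hCY : CY.PosDef)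
    (lam : Fin n → ℝ) (hlam : Antitone lam)
    (P : Matrix (Fin n) (Fin n) ℝ) (hP : Pᵀ * CE * P = 1)
    (hgen : CY * P = CE * P * Matrix.diagonal lam)
    (V : Matrix (Fin n) (Fin r) ℝ) (hV : V = P.submatrix id (Fin.castLE hrn)) :
    V.rank = r ∧
    (1 / 2) * Real.log ((Vᵀ * CY * V) * (Vᵀ * CE * V)⁻¹).det =
      (1 / 2) * ∑ i : Fin r, Real.log (lam (Fin.castLE hrn i)) ∧
    ∀ V' : Matrix (Fin n) (Fin r) ℝ, V'.rank = r →
      (1 / 2) * Real.log ((V'ᵀ * CY * V') * (V'ᵀ * CE * V')⁻¹).det ≤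
        (1 / 2) * Real.log ((Vᵀ * CY * V) * (Vᵀ * CE * V)⁻¹).det := by
  have hPinj : Function.Injective P.mulVec :=
    mulVec_injective_of_isUnit (IsUnit.of_mul_eq_one_right _ hP)
  have hdiag : Pᵀ * CY * P = diagonal lam := by
    rw [Matrix.mul_assoc, hgen, ← Matrix.mul_assoc, ← Matrix.mul_assoc, hP, Matrix.one_mul]
  have hpos : ∀ i, 0 < lam i := by
    have h := hCY.conjTranspose_mul_mul_same hPinj
    rw [conjTranspose_eq_transpose_of_trivial, hdiag] at h
    exact posDef_diagonal_iff.1 h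
  have hVE : Vᵀ * CE * V = 1 := by
    have h : Vᵀ * CE * V =
        (Pᵀ * CE * P).submatrix (Fin.castLE hrn) (Fin.castLE hrn) := by
      subst hV; rfl
    rw [h, hP, submatrix_one _ (Fin.castLE_injective hrn)]
  have hVY : Vᵀ * CY * V = diagonal fun i => lam (Fin.castLE hrn i) := by
    have h : Vᵀ * CY * V =
        (Pᵀ * CY * P).submatrix (Fin.castLE hrn) (Fin.castLE hrn) := by
      subst hV; rfl
    rw [h, hdiag, submatrix_diagonal _ _ (Fin.castLE_injective hrn)]
    rfl
  have hval : ((Vᵀ * CY * V) * (Vᵀ * CE * V)⁻¹).det = ∏ i, lam (Fin.castLE hrn i) := by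
    rw [hVE, inv_one, Matrix.mul_one, hVY, det_diagonal]
  refine ⟨le_antisymm (by simpa using V.rank_le_width) ?_, ?_, fun V' hV' => ?_⟩
  · calc r = (Vᵀ * CE * V).rank := by rw [hVE, rank_one, Fintype.card_fin]
      _ ≤ V.rank := rank_mul_le_right _ _
  · rw [hval, Real.log_prod fun i _ => (hpos _).ne']
  · have hinj : Function.Injective V'.mulVec :=
      mulVec_injective_of_rank_eq (by rw [hV', Fintype.card_fin])
    have hEpos : 0 < (V'ᵀ * CE * V').det := by
      simpa using (hCE.conjTranspose_mul_mul_same hinj).det_pos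
    have hYpos : 0 < (V'ᵀ * CY * V').det := by
      simpa using (hCY.conjTranspose_mul_mul_same hinj).det_pos
    obtain ⟨W, rfl⟩ : ∃ W, V' = P * W :=
      ⟨Pᵀ * CE * V', by
        rw [← Matrix.mul_assoc, mul_eq_one_comm.1 hP, Matrix.one_mul]⟩
    have hE : (P * W)ᵀ * CE * (P * W) = Wᵀ * W := by
      calc (P * W)ᵀ * CE * (P * W) = Wᵀ * (Pᵀ * CE * P) * W := by
            simp only [transpose_mul, Matrix.mul_assoc]
        _ = Wᵀ * W := by rw [hP, Matrix.mul_one]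
    have hY : (P * W)ᵀ * CY * (P * W) = Wᵀ * diagonal lam * W := by
      rw [← hdiag]
      simp only [transpose_mul, Matrix.mul_assoc]
    have hdet : (((P * W)ᵀ * CY * (P * W)) * ((P * W)ᵀ * CE * (P * W))⁻¹).det =
        ((P * W)ᵀ * CY * (P * W)).det / ((P * W)ᵀ * CE * (P * W)).det := by
      rw [det_mul, det_nonsing_inv, Ring.inverse_eq_inv', div_eq_mul_inv]
    rw [hval, hdet]
    refine mul_le_mul_of_nonneg_left (Real.log_le_log (div_pos hYpos hEpos) ?_) (by norm_num)
    rw [div_le_iff₀ hEpos, hE, hY]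
    exact det_transpose_mul_diagonal_mul_le hrn hlam (fun i => (hpos i).le) W
end

section
/- Let C_X ∈ ℝ^{q×q} and C_E ∈ ℝ^{n×n} be symmetric positive definite, B ∈ ℝ^{n×q}, C_Y = B C_X Bᵀ + C_E, and let V ∈ ℝ^{n×r} have full column rank r. Let C_V = C_X − C_X Bᵀ V (Vᵀ C_Y V)⁻¹ Vᵀ B C_X be the reduced posterior covariance. Then det(C_V) = det(C_X) · det(Vᵀ C_E V) / det(Vᵀ C_Y V); equivalently, log det(C_V) = log det(C_X) − log det( (Vᵀ C_Y V)(Vᵀ C_E V)⁻¹ ). -/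
open Matrix

/-- The two Schur complement formulas for the determinant of a block matrix agree. -/
theorem Matrix.det_schur_complement_mul_det {m k R : Type*} [Fintype m] [DecidableEq m]
    [Fintype k] [DecidableEq k] [CommRing R] {A : Matrix m m R} {D : Matrix k k R}
    (hA : IsUnit A.det) (hD : IsUnit D.det) (B : Matrix m k R) (C : Matrix k m R) :
    (A - B * D⁻¹ * C).det * D.det = A.det * (D - C * A⁻¹ * B).det := by
  let := A.invertibleOfIsUnitDet hA
  let := D.invertibleOfIsUnitDet hD
  rw [← invOf_eq_nonsing_inv, ← invOf_eq_nonsing_inv, mul_comm, ← det_fromBlocks₂₂,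
    det_fromBlocks₁₁]

theorem Matrix.mulVec_injective_of_rank_eq_card_s14 {m k K : Type*} [Fintype m] [Fintype k] [Field K]
    {V : Matrix m k K} (hV : V.rank = Fintype.card k) : Function.Injective V.mulVec := by
  rw [mulVec_injective_iff, linearIndependent_iff_card_eq_finrank_span, ← hV,
    rank_eq_finrank_span_cols, Set.finrank]

theorem Matrix.PosDef.transpose_mul_mul_same_s14 {m k : Type*} [Fintype m] [Fintype k]
    {A : Matrix m m ℝ} (hA : A.PosDef) {V : Matrix m k ℝ} (hV : V.rank = Fintype.card k) :
    (Vᵀ * A * V).PosDef := by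
  simpa only [conjTranspose_eq_transpose_of_trivial] using
    hA.conjTranspose_mul_mul_same (mulVec_injective_of_rank_eq_card_s14 hV)

/-- Determinant identity (Appendix F, Theorem 3.6): for the reduced posterior
covariance `C_V = C_X − C_X Bᵀ V (Vᵀ C_Y V)⁻¹ Vᵀ B C_X`,
`det(C_V) = det(C_X) · det(Vᵀ C_E V) / det(Vᵀ C_Y V)`, equivalently
`log det(C_V) = log det(C_X) − log det((Vᵀ C_Y V)(Vᵀ C_E V)⁻¹)`. -/
theorem stmt_14 {q n r : ℕ} (hr : 1 ≤ r) (hrn : r ≤ n)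
    (CX : Matrix (Fin q) (Fin q) ℝ) (CE : Matrix (Fin n) (Fin n) ℝ)
    (hCX : CX.PosDef) (hCE : CE.PosDef)
    (B : Matrix (Fin n) (Fin q) ℝ)
    (CY : Matrix (Fin n) (Fin n) ℝ) (hCY : CY = B * CX * Bᵀ + CE)
    (V : Matrix (Fin n) (Fin r) ℝ) (hV : V.rank = r)
    (CV : Matrix (Fin q) (Fin q) ℝ)
    (hCV : CV = CX - CX * Bᵀ * V * (Vᵀ * CY * V)⁻¹ * Vᵀ * B * CX) :
    CV.det = CX.det * (Vᵀ * CE * V).det / (Vᵀ * CY * V).det ∧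
    Real.log CV.det =
      Real.log CX.det - Real.log ((Vᵀ * CY * V) * (Vᵀ * CE * V)⁻¹).det := by
  have hrank : V.rank = Fintype.card (Fin r) := by simpa using hV
  have hCYpos : CY.PosDef := by
    rw [hCY, ← conjTranspose_eq_transpose_of_trivial B]
    exact PosDef.posSemidef_add (hCX.posSemidef.mul_mul_conjTranspose_same B) hCE
  have hX := hCX.det_pos
  have hE := (hCE.transpose_mul_mul_same_s14 hrank).det_pos
  have hY := (hCYpos.transpose_mul_mul_same_s14 hrank).det_pos
  have hSchur : Vᵀ * CY * V - Vᵀ * B * CX * CX⁻¹ * (CX * Bᵀ * V) = Vᵀ * CE * V := by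
    rw [mul_nonsing_inv_cancel_right _ _ hX.ne'.isUnit, hCY]
    simp only [Matrix.mul_add, Matrix.add_mul, Matrix.mul_assoc, add_sub_cancel_left]
  have hdet : CV.det = CX.det * (Vᵀ * CE * V).det / (Vᵀ * CY * V).det := by
    rw [eq_div_iff hY.ne', hCV, ← hSchur,
      ← det_schur_complement_mul_det hX.ne'.isUnit hY.ne'.isUnit]
    simp only [Matrix.mul_assoc]
  refine ⟨hdet, ?_⟩
  rw [hdet, det_mul, det_nonsing_inv, Ring.inverse_eq_inv', ← div_eq_mul_inv,
    Real.log_div (mul_pos hX hE).ne' hY.ne', Real.log_mul hX.ne' hE.ne',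
    Real.log_div hY.ne' hE.ne']
  ring
end

section
/- Let K ∈ ℝ^{n×n} be symmetric positive definite and 1 ≤ r ≤ n. If U* ∈ ℝ^{n×r} with (U*)ᵀ U* = I_r maximizes U ↦ det(Uᵀ K U) over {U ∈ ℝ^{n×r} : Uᵀ U = I_r}, then K U* = U* ((U*)ᵀ K U*); that is, the column span of any maximizer is an r-dimensional invariant subspace of K. -/
open Matrix

/-- The supremum of `det (Uᵀ K U)` over matrices with orthonormal columns bounds the
generalized Rayleigh quotient `det (Vᵀ K V) / det (Vᵀ V)`. -/
lemma det_le_det_gram_mul {m ι : Type*} [Fintype m] [Fintype ι] [DecidableEq ι]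
    (K : Matrix m m ℝ) (c : ℝ)
    (hc : ∀ U : Matrix m ι ℝ, Uᵀ * U = 1 → (Uᵀ * K * U).det ≤ c)
    (V : Matrix m ι ℝ) (hV : (Vᵀ * V).PosDef) :
    (Vᵀ * K * V).det ≤ (Vᵀ * V).det * c := by
  open scoped MatrixOrder in
  obtain ⟨B, hB⟩ := CStarAlgebra.nonneg_iff_eq_star_mul_self.mp hV.posSemidef.nonneg
  have hB' : Vᵀ * V = Bᵀ * B := by
    simpa [star_eq_conjTranspose, conjTranspose_eq_transpose_of_trivial] using hB
  have hdet : (Vᵀ * V).det = B.det ^ 2 := by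
    rw [hB', det_mul, det_transpose, sq]
  have hB0 : B.det ≠ 0 := fun h => by
    have := hV.det_pos
    simp [hdet, h] at this
  have hu : IsUnit B.det := hB0.isUnit
  have hut : IsUnit Bᵀ.det := by rwa [det_transpose]
  have horth : (V * B⁻¹)ᵀ * (V * B⁻¹) = 1 := by
    rw [transpose_mul, transpose_nonsing_inv,
      show Bᵀ⁻¹ * Vᵀ * (V * B⁻¹) = Bᵀ⁻¹ * (Vᵀ * V) * B⁻¹ by simp only [Matrix.mul_assoc], hB',
      nonsing_inv_mul_cancel_left _ _ hut, mul_nonsing_inv _ hu]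
  have hfac : Vᵀ * K * V = Bᵀ * ((V * B⁻¹)ᵀ * K * (V * B⁻¹)) * B := by
    have hVB : V = V * B⁻¹ * B := by rw [nonsing_inv_mul_cancel_right _ _ hu]
    conv_lhs => rw [hVB]
    rw [transpose_mul]
    simp only [Matrix.mul_assoc]
  rw [hdet, hfac, det_mul, det_mul, det_transpose]
  nlinarith [mul_le_mul_of_nonneg_left (hc _ horth) (sq_nonneg B.det)]

/-- Determinant of a symmetric rank-two perturbation of a symmetric matrix. -/
lemma det_add_symm_rank_two {ι : Type*} [Fintype ι] [DecidableEq ι] {M : Matrix ι ι ℝ}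
    (hM : Mᵀ = M) (hu : IsUnit M.det) (a b : ι → ℝ) (t k : ℝ) :
    (M + (t • (vecMulVec b a + vecMulVec a b) + (t ^ 2 * k) • vecMulVec a a)).det =
      M.det * ((1 + t * (a ⬝ᵥ M⁻¹ *ᵥ b)) ^ 2 +
        t ^ 2 * ((k - b ⬝ᵥ M⁻¹ *ᵥ b) * (a ⬝ᵥ M⁻¹ *ᵥ a))) := by
  have hsplit : t • (vecMulVec b a + vecMulVec a b) + (t ^ 2 * k) • vecMulVec a a =
      (of ![t • b + (t ^ 2 * k) • a, t • a])ᵀ * of ![a, b] := by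
    ext i j
    simp [Matrix.mul_apply, vecMulVec_apply, Fin.sum_univ_two]
    ring
  have hsymm : b ⬝ᵥ M⁻¹ *ᵥ a = a ⬝ᵥ M⁻¹ *ᵥ b := by
    rw [dotProduct_mulVec, dotProduct_comm, ← mulVec_transpose, transpose_nonsing_inv, hM]
  have hentry : ∀ x y : Fin 2 → ι → ℝ, ∀ i j,
      (of x * M⁻¹ * (of y)ᵀ) i j = x i ⬝ᵥ M⁻¹ *ᵥ y j := by
    intro x y i j
    rw [Matrix.mul_assoc]
    rfl
  rw [hsplit, det_add_mul _ _ hu, det_fin_two]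
  congr 1
  simp only [Matrix.add_apply, hentry]
  simp [mulVec_add, mulVec_smul, hsymm]
  ring

lemma eq_zero_of_forall_linear_add_sq_nonpos {s c : ℝ}
    (h : ∀ t : ℝ, 2 * t * s + t ^ 2 * c ≤ 0) : s = 0 := by
  have hpos : 0 < 1 + |c| := by positivity
  have ht := h (s / (1 + |c|))
  have heq : 2 * (s / (1 + |c|)) * s + (s / (1 + |c|)) ^ 2 * c =
      s ^ 2 * (2 * (1 + |c|) + c) / (1 + |c|) ^ 2 := by
    field_simp
  rw [heq, div_le_iff₀ (by positivity), zero_mul] at ht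
  have hc : 0 < 2 * (1 + |c|) + c := by linarith [neg_abs_le c, abs_nonneg c]
  have : s ^ 2 ≤ 0 := nonpos_of_mul_nonpos_left ht hc
  exact pow_eq_zero_iff two_ne_zero |>.mp (le_antisymm this (sq_nonneg s))

lemma transpose_mul_mul_rank_one_perturb {m ι : Type*} [Fintype m]
    {K : Matrix m m ℝ} (hK : Kᵀ = K) (U : Matrix m ι ℝ) (w : m → ℝ) (a : ι → ℝ) (t : ℝ) :
    (U + t • vecMulVec w a)ᵀ * K * (U + t • vecMulVec w a) =
      Uᵀ * K * U + (t • (vecMulVec (Uᵀ *ᵥ K *ᵥ w) a + vecMulVec a (Uᵀ *ᵥ K *ᵥ w)) +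
        (t ^ 2 * (w ⬝ᵥ K *ᵥ w)) • vecMulVec a a) := by
  have hKU : w ᵥ* K ᵥ* U = Uᵀ *ᵥ K *ᵥ w := by
    rw [← mulVec_transpose, ← mulVec_transpose, hK]
  have hKw : w ᵥ* K ⬝ᵥ w = w ⬝ᵥ K *ᵥ w := (dotProduct_mulVec _ _ _).symm
  simp only [transpose_add, transpose_smul, transpose_vecMulVec, Matrix.add_mul,
    Matrix.mul_add, Matrix.smul_mul, Matrix.mul_smul, mul_vecMulVec, vecMulVec_mul,
    add_mulVec, smul_mulVec, vecMulVec_mulVec, ← mulVec_mulVec, hKU, hKw]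
  ext i j
  simp [vecMulVec_apply]
  ring

/-- First-order condition: at a maximizer `U`, every direction `w` orthogonal to the columns
of `U` is also `K`-orthogonal to them. -/
lemma transpose_mul_mulVec_eq_zero_of_isMax {m ι : Type*} [Fintype m] [Fintype ι]
    [DecidableEq ι] {K : Matrix m m ℝ} (hK : K.PosDef)
    {U : Matrix m ι ℝ} (hU : Uᵀ * U = 1)
    (hmax : ∀ V : Matrix m ι ℝ, Vᵀ * V = 1 → (Vᵀ * K * V).det ≤ (Uᵀ * K * U).det)
    {w : m → ℝ} (hw : Uᵀ *ᵥ w = 0) : Uᵀ *ᵥ K *ᵥ w = 0 := by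
  have hKt : Kᵀ = K := by simpa [conjTranspose_eq_transpose_of_trivial] using hK.1.eq
  have hinj : Function.Injective U.mulVec := fun x y hxy => by
    simpa [mulVec_mulVec, hU] using congrArg (Uᵀ *ᵥ ·) hxy
  have hMpos : (Uᵀ * K * U).PosDef := by
    simpa [conjTranspose_eq_transpose_of_trivial] using hK.conjTranspose_mul_mul_same hinj
  set M := Uᵀ * K * U with hMdef
  have hMt : Mᵀ = M := by simpa [conjTranspose_eq_transpose_of_trivial] using hMpos.1.eq
  have hu : IsUnit M.det := hMpos.det_pos.ne'.isUnit
  set b := Uᵀ *ᵥ K *ᵥ w with hb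
  set a := M *ᵥ b with ha
  have hs : a ⬝ᵥ M⁻¹ *ᵥ b = b ⬝ᵥ b := by
    rw [dotProduct_mulVec, ← mulVec_transpose, transpose_nonsing_inv, hMt, ha, mulVec_mulVec,
      nonsing_inv_mul _ hu, one_mulVec]
  have hgram : ∀ t : ℝ, (U + t • vecMulVec w a)ᵀ * (U + t • vecMulVec w a) =
      1 + (t ^ 2 * (w ⬝ᵥ w)) • vecMulVec a a := by
    intro t
    classical
    simpa [hU, hw] using transpose_mul_mul_rank_one_perturb transpose_one U w a t
  have hquad : ∀ t : ℝ, (U + t • vecMulVec w a)ᵀ * K * (U + t • vecMulVec w a) =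
      M + (t • (vecMulVec b a + vecMulVec a b) +
        (t ^ 2 * (w ⬝ᵥ K *ᵥ w)) • vecMulVec a a) :=
    transpose_mul_mul_rank_one_perturb hKt U w a
  have hzero : a ⬝ᵥ M⁻¹ *ᵥ b = 0 := by
    apply eq_zero_of_forall_linear_add_sq_nonpos (c := (a ⬝ᵥ M⁻¹ *ᵥ b) ^ 2 +
      (w ⬝ᵥ K *ᵥ w - b ⬝ᵥ M⁻¹ *ᵥ b) * (a ⬝ᵥ M⁻¹ *ᵥ a) - (w ⬝ᵥ w) * (a ⬝ᵥ a))
    intro t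
    have hpd : ((U + t • vecMulVec w a)ᵀ * (U + t • vecMulVec w a)).PosDef := by
      rw [hgram]
      refine PosDef.one.add_posSemidef (PosSemidef.smul ?_ ?_)
      · simpa using posSemidef_vecMulVec_self_star a
      · exact mul_nonneg (sq_nonneg t) (by simpa using dotProduct_star_self_nonneg w)
    have hle := det_le_det_gram_mul K _ hmax _ hpd
    have hdet1 : (1 + (t ^ 2 * (w ⬝ᵥ w)) • vecMulVec a a).det =
        1 + t ^ 2 * (w ⬝ᵥ w) * (a ⬝ᵥ a) := by
      rw [← smul_vecMulVec, vecMulVec_eq Unit, det_one_add_replicateCol_mul_replicateRow,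
        dotProduct_smul, smul_eq_mul]
    rw [hquad, hgram, det_add_symm_rank_two hMt hu, hdet1, mul_comm _ M.det] at hle
    have := le_of_mul_le_mul_left hle hMpos.det_pos
    linarith
  exact dotProduct_self_eq_zero.mp (hs ▸ hzero)

/-- Stationarity characterization in the proof of Lemma F.1: any maximizer
`U*` of `U ↦ det(Uᵀ K U)` over the Stiefel manifold satisfies
`K U* = U* ((U*)ᵀ K U*)`, i.e.\ its column span is an invariant subspace of `K`. -/
theorem stmt_16 {n r : ℕ} (hr : 1 ≤ r) (hrn : r ≤ n)
    (K : Matrix (Fin n) (Fin n) ℝ) (hK : K.PosDef)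
    (Us : Matrix (Fin n) (Fin r) ℝ) (hUs : Usᵀ * Us = 1)
    (hmax : ∀ U : Matrix (Fin n) (Fin r) ℝ, Uᵀ * U = 1 →
      (Uᵀ * K * U).det ≤ (Usᵀ * K * Us).det) :
    K * Us = Us * (Usᵀ * K * Us) := by
  have hKt : Kᵀ = K := by simpa [conjTranspose_eq_transpose_of_trivial] using hK.1.eq
  set W := K * Us - Us * (Usᵀ * K * Us) with hW
  have hUW : Usᵀ * W = 0 := by
    rw [hW, Matrix.mul_sub, ← Matrix.mul_assoc Usᵀ Us, hUs, Matrix.one_mul, Matrix.mul_assoc,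
      sub_self]
  have hUKW : Usᵀ * (K * W) = 0 := by
    ext i j
    have hcol : Usᵀ *ᵥ W.col j = 0 := funext fun i => congrFun (congrFun hUW i) j
    exact congrFun (transpose_mul_mulVec_eq_zero_of_isMax hK hUs hmax hcol) i
  have hWW : Wᴴ * W = 0 := by
    rw [conjTranspose_eq_transpose_of_trivial]
    nth_rewrite 1 [hW]
    rw [transpose_sub, transpose_mul, transpose_mul Us, hKt, Matrix.sub_mul, Matrix.mul_assoc,
      hUKW, Matrix.mul_assoc, hUW, Matrix.mul_zero, sub_zero]
  exact sub_eq_zero.mp (conjTranspose_mul_self_eq_zero.mp hWW)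
end
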